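/- Let R be a commutative ring with identity and let q be an integer. The map φ^q : R^{ℕ≥1} → R^{ℕ≥1}, defined by φ^q(x)_n = ∑_{d|n} q^{n/d − 1}·x_d, is a bijective homomorphism of additive groups (where both source and target carry componentwise addition). -/

import Mathlib

open Finset

/-- Extend a sequence indexed by positive integers to all of `ℕ` by `0`. -/
def seqExt {R : Type*} [Zero R] (x : ℕ+ → R) : ℕ → R :=
  fun n => if h : 0 < n then x ⟨n, h⟩ else 0

/-- The `q`-aperiodic ghost map `φ^q(x)_n = ∑_{d|n} q^{n/d−1}·x_d`. -/
def qApGhostMap {R : Type*} [CommRing R] (q : ℤ) (x : ℕ+ → R) : ℕ+ → R :=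
  fun n => ∑ d ∈ (n : ℕ).divisors, (q : R) ^ ((n : ℕ) / d - 1) * seqExt x d

theorem seqExt_coe {R : Type*} [Zero R] (x : ℕ+ → R) (n : ℕ+) : seqExt x n = x n :=
  dif_pos n.pos

theorem seqExt_add {R : Type*} [AddZeroClass R] (x y : ℕ+ → R) (n : ℕ) :
    seqExt (x + y) n = seqExt x n + seqExt y n := by
  unfold seqExt
  split_ifs
  · rfl
  · exact (add_zero 0).symm

theorem qApGhostMap_add {R : Type*} [CommRing R] (q : ℤ) (x y : ℕ+ → R) :
    qApGhostMap q (x + y) = qApGhostMap q x + qApGhostMap q y := by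
  funext n
  simp only [qApGhostMap, Pi.add_apply, seqExt_add, mul_add, sum_add_distrib]

/-- The ghost map is unitriangular with respect to divisibility. -/
theorem qApGhostMap_apply_eq_add_properDivisors {R : Type*} [CommRing R] (q : ℤ)
    (x : ℕ+ → R) (n : ℕ+) :
    qApGhostMap q x n =
      x n + ∑ d ∈ (n : ℕ).properDivisors, (q : R) ^ ((n : ℕ) / d - 1) * seqExt x d := by
  rw [qApGhostMap, ← Nat.insert_self_properDivisors n.ne_zero,
    sum_insert Nat.self_notMem_properDivisors, Nat.div_self n.pos, seqExt_coe]
  simp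

theorem qApGhostMap_injective {R : Type*} [CommRing R] (q : ℤ) :
    Function.Injective (qApGhostMap (R := R) q) := by
  intro x y hxy
  funext n
  induction n using PNat.strongInductionOn with
  | _ n ih =>
    have h := congrFun hxy n
    simp only [qApGhostMap_apply_eq_add_properDivisors] at h
    have hsum : ∑ d ∈ (n : ℕ).properDivisors, (q : R) ^ ((n : ℕ) / d - 1) * seqExt x d =
        ∑ d ∈ (n : ℕ).properDivisors, (q : R) ^ ((n : ℕ) / d - 1) * seqExt y d := by
      refine sum_congr rfl fun d hd => ?_
      lift d to ℕ+ using Nat.pos_of_mem_properDivisors hd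
      rw [seqExt_coe, seqExt_coe, ih d (Nat.mem_properDivisors.mp hd).2]
    rw [hsum] at h
    exact add_right_cancel h

/-- The preimage of a sequence under the ghost map, defined by recursion on the index. -/
def qApGhostPreimage {R : Type*} [CommRing R] (q : ℤ) (y : ℕ+ → R) (n : ℕ) : R :=
  seqExt y n - ∑ d ∈ n.properDivisors.attach,
    (q : R) ^ (n / d - 1) * qApGhostPreimage q y d
termination_by n
decreasing_by exact (Nat.mem_properDivisors.mp d.2).2

theorem qApGhostMap_surjective {R : Type*} [CommRing R] (q : ℤ) :
    Function.Surjective (qApGhostMap (R := R) q) := by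
  intro y
  refine ⟨fun n => qApGhostPreimage q y n, funext fun n => ?_⟩
  rw [qApGhostMap_apply_eq_add_properDivisors, qApGhostPreimage, seqExt_coe,
    sum_attach _ fun d => (q : R) ^ ((n : ℕ) / d - 1) * qApGhostPreimage q y d,
    sub_add, sub_eq_self, sub_eq_zero]
  refine sum_congr rfl fun d hd => ?_
  lift d to ℕ+ using Nat.pos_of_mem_properDivisors hd
  rw [seqExt_coe]

/-- For any commutative ring `R` and integer `q`, the map
`φ^q(x)_n = ∑_{d|n} q^{n/d−1}·x_d` is a bijective homomorphism of additive groups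
(source and target carrying componentwise addition). -/
theorem qApGhostMap_bijective_additive (R : Type*) [CommRing R] (q : ℤ) :
    Function.Bijective (qApGhostMap (R := R) q) ∧
      ∀ x y : ℕ+ → R, qApGhostMap q (x + y) = qApGhostMap q x + qApGhostMap q y :=
  ⟨⟨qApGhostMap_injective q, qApGhostMap_surjective q⟩, qApGhostMap_add q⟩
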